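/- Let n be a positive integer, let c be a prime power with c ≡ 1 (mod 2n), let 𝔽 be the finite field of order c, let ζ be a generator of 𝔽ˣ, let H ≤ Sym(𝔽) be the group of affine permutations x ↦ ax + b with b ∈ 𝔽, a ∈ ⟨ζⁿ⟩, let d ≥ 2 be an integer, let R = {0, 1, …, d−1}, and let G ≤ Sym(𝔽 × R) be the group of all permutations of the form (x, j) ↦ (h_j(x), σ(j)) with h₀, …, h_{d−1} ∈ H and σ ∈ Sym(R). Then: (a) the partition of 𝔽 × R into the classes C_j = 𝔽 × {j} (j ∈ R) is G-invariant and nontrivial; (b) G is transitive on the set of outer pairs (2-element subsets of 𝔽 × R whose points lie in distinct classes), and the number of outer pairs is c²d(d−1)/2; (c) G has exactly n orbits on the set of inner pairs (2-element subsets lying inside a single class), namely the sets 𝒪_{inn,i} = { {(x,j), (y,j)} : y − x ∈ ζⁱ⟨ζⁿ⟩, j ∈ R } for 0 ≤ i < n, and each of these orbits has size dc(c−1)/(2n). -/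

import Mathlib

open Finset

/-- Number of inner pairs of `B` with respect to the partition `𝒞`:
2-subsets of `B` contained in a single class of `𝒞`. -/
def innerPairs {P : Type*} [DecidableEq P] (𝒞 : Finset (Finset P)) (B : Finset P) : ℕ :=
  ((B.powersetCard 2).filter (fun p => ∃ C ∈ 𝒞, p ⊆ C)).card

/-- Number of outer pairs of `B` with respect to the partition `𝒞`:
2-subsets of `B` not contained in a single class of `𝒞`. -/
def outerPairs {P : Type*} [DecidableEq P] (𝒞 : Finset (Finset P)) (B : Finset P) : ℕ :=
  ((B.powersetCard 2).filter (fun p => ¬ ∃ C ∈ 𝒞, p ⊆ C)).card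

/-- The rank of a permutation group `X ≤ Sym(Ω)`: the number of `X`-orbits on `Ω × Ω`. -/
noncomputable def permRank {Ω : Type*} (X : Subgroup (Equiv.Perm Ω)) : ℕ :=
  Nat.card {O : Set (Ω × Ω) // ∃ p : Ω × Ω, O = {q | ∃ g ∈ X, (g p.1, g p.2) = q}}

/-- The pair-rank of a permutation group `X ≤ Sym(Ω)`: the number of `X`-orbits on
the 2-element subsets of `Ω`. -/
noncomputable def permPairRank {Ω : Type*} [DecidableEq Ω] (X : Subgroup (Equiv.Perm Ω)) : ℕ :=
  Nat.card {O : Set (Finset Ω) // ∃ s : Finset Ω, s.card = 2 ∧ O = {t | ∃ g ∈ X, s.image ⇑g = t}}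

/-- The orbits of `s` and `t` under the setwise action of a permutation group agree exactly when
some group element carries `s` to `t`. -/
lemma imageOrbit_eq_iff {Ω : Type*} [DecidableEq Ω] (G : Subgroup (Equiv.Perm Ω))
    (s t : Finset Ω) :
    ({r | ∃ g ∈ G, s.image ⇑g = r} : Set (Finset Ω)) = {r | ∃ g ∈ G, t.image ⇑g = r} ↔
      ∃ g ∈ G, s.image ⇑g = t := by
  constructor
  · intro h
    have ht : t ∈ ({r | ∃ g ∈ G, t.image ⇑g = r} : Set (Finset Ω)) :=
      ⟨1, G.one_mem, by simp⟩
    rwa [← h] at ht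
  · rintro ⟨g, hg, rfl⟩
    ext r
    constructor
    · rintro ⟨k, hk, rfl⟩
      refine ⟨k * g⁻¹, G.mul_mem hk (G.inv_mem hg), ?_⟩
      rw [Finset.image_image]
      congr 1
      ext x
      simp
    · rintro ⟨k, hk, rfl⟩
      refine ⟨k * g, G.mul_mem hk hg, ?_⟩
      rw [Finset.image_image]
      rfl

/-- An irreflexive symmetric family of ordered pairs, enumerated without repetition, has twice
as many members as the family of underlying unordered pairs. -/
lemma two_mul_ncard_unorderedPairs {ι α : Type*} [Fintype ι] [DecidableEq α] (f : ι → α × α)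
    (hf : Function.Injective f) (hne : ∀ i, (f i).1 ≠ (f i).2)
    (hsymm : ∀ i, ∃ k, f k = (f i).swap) :
    2 * Set.ncard {s : Finset α | ∃ i, s = {(f i).1, (f i).2}} = Fintype.card ι := by
  classical
  set φ : ι → Finset α := fun i => {(f i).1, (f i).2} with hφ
  have hset : {s : Finset α | ∃ i, s = {(f i).1, (f i).2}} = ↑(Finset.univ.image φ) := by
    ext s
    simp [hφ, eq_comm]
  rw [hset, Set.ncard_coe_finset, ← Finset.card_univ,
    Finset.card_eq_sum_card_image φ Finset.univ, mul_comm, ← smul_eq_mul]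
  refine (Finset.sum_const_nat ?_).symm
  intro s hs
  obtain ⟨i, -, rfl⟩ := Finset.mem_image.1 hs
  obtain ⟨k, hk⟩ := hsymm i
  rw [Finset.card_eq_two]
  refine ⟨i, k, ?_, ?_⟩
  · rintro rfl
    exact hne i (congrArg Prod.fst hk)
  · ext l
    simp only [Finset.mem_filter, Finset.mem_univ, true_and, Finset.mem_insert,
      Finset.mem_singleton, hφ]
    rw [← hf.eq_iff, ← hf.eq_iff (b := k), hk, ← Finset.coe_inj]
    push_cast
    rw [Set.pair_eq_pair_iff, Prod.ext_iff, Prod.ext_iff]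
    rfl

/-- The affine permutation `x ↦ a * x + b`. -/
def affinePerm {F : Type*} [Field F] (a : Fˣ) (b : F) : Equiv.Perm F :=
  a.mulLeft.trans (Equiv.addRight b)

lemma affinePerm_apply {F : Type*} [Field F] (a : Fˣ) (b x : F) :
    affinePerm a b x = a * x + b := rfl

/-- The permutation `(x, j) ↦ (h j x, σ j)` of `α × ι`. -/
def wreathPerm {α ι : Type*} (h : ι → Equiv.Perm α) (σ : Equiv.Perm ι) : Equiv.Perm (α × ι) :=
  (Equiv.prodCongrLeft h).trans ((Equiv.refl α).prodCongr σ)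

lemma wreathPerm_apply {α ι : Type*} (h : ι → Equiv.Perm α) (σ : Equiv.Perm ι) (p : α × ι) :
    wreathPerm h σ p = (h p.2 p.1, σ p.2) := rfl

lemma exists_perm_apply_eq_and_apply_eq {ι : Type*} [DecidableEq ι] {j k j' k' : ι}
    (hjk : j ≠ k) (hjk' : j' ≠ k') : ∃ σ : Equiv.Perm ι, σ j = j' ∧ σ k = k' := by
  refine ⟨(Equiv.swap j j').trans (Equiv.swap (Equiv.swap j j' k) k'), ?_, by simp⟩
  rw [Equiv.trans_apply, Equiv.swap_apply_left, Equiv.swap_apply_of_ne_of_ne _ hjk']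
  exact fun h => hjk ((Equiv.swap j j').injective (by rwa [Equiv.swap_apply_left]))

lemma card_zpowers_pow_mul {A : Type*} [Group A] [Finite A] {ζ : A}
    (hζ : ∀ u : A, u ∈ Subgroup.zpowers ζ) {n : ℕ} (hn : n ∣ Nat.card A) :
    Nat.card (Subgroup.zpowers (ζ ^ n)) * n = Nat.card A := by
  have ho : orderOf ζ = Nat.card A := orderOf_eq_card_of_forall_mem_zpowers hζ
  rw [Nat.card_zpowers, orderOf_pow_of_dvd, ho, Nat.div_mul_cancel hn]
  · rintro rfl
    exact Nat.card_pos.ne' (Nat.eq_zero_of_zero_dvd hn)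
  · rwa [ho]

lemma index_zpowers_pow {A : Type*} [Group A] [Finite A] {ζ : A}
    (hζ : ∀ u : A, u ∈ Subgroup.zpowers ζ) {n : ℕ} (hn : n ∣ Nat.card A) :
    (Subgroup.zpowers (ζ ^ n)).index = n := by
  have h := card_zpowers_pow_mul hζ hn
  rw [← Subgroup.card_mul_index (Subgroup.zpowers (ζ ^ n))] at h
  exact (Nat.eq_of_mul_eq_mul_left Nat.card_pos h).symm

/-- In a cyclic group, an involution is an `n`-th power as soon as `2 * n` divides the order. -/
lemma mem_zpowers_pow_of_sq_eq_one {A : Type*} [Group A] [Finite A] {ζ : A}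
    (hζ : ∀ u : A, u ∈ Subgroup.zpowers ζ) {n : ℕ} (hn : 2 * n ∣ Nat.card A) {v : A}
    (hv : v ^ 2 = 1) : v ∈ Subgroup.zpowers (ζ ^ n) := by
  obtain ⟨m, rfl⟩ := Subgroup.mem_zpowers_iff.1 (hζ v)
  have ho : orderOf ζ = Nat.card A := orderOf_eq_card_of_forall_mem_zpowers hζ
  have hdvd : ((2 * n : ℕ) : ℤ) ∣ m * 2 := by
    refine (Int.natCast_dvd_natCast.2 (ho ▸ hn)).trans ?_
    rw [orderOf_dvd_iff_zpow_eq_one, zpow_mul]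
    exact_mod_cast hv
  obtain ⟨l, hl⟩ : (n : ℤ) ∣ m := by
    obtain ⟨l, hl⟩ := hdvd
    refine ⟨l, ?_⟩
    push_cast at hl
    linarith
  exact Subgroup.mem_zpowers_iff.2 ⟨l, by rw [hl, zpow_mul, zpow_natCast]⟩

/-- **Lemma 5.2.** Properties of the imprimitive action of `G = H ≀ Sym(d)` on `𝔽 × R`,
where `H ≤ AGL(1, c)` is as in Lemma 5.1 and `R = {0, …, d−1}`. -/
theorem wreath_action_lemma
    (n c d : ℕ) (hn : 0 < n) (hmod : c % (2 * n) = 1) (hd : 2 ≤ d)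
    (𝔽 : Type*) [Field 𝔽] [Fintype 𝔽] [DecidableEq 𝔽]
    (hcard : Fintype.card 𝔽 = c)
    (ζ : 𝔽ˣ) (hζ : ∀ u : 𝔽ˣ, u ∈ Subgroup.zpowers ζ)
    (H : Subgroup (Equiv.Perm 𝔽))
    (hH : ∀ h : Equiv.Perm 𝔽, h ∈ H ↔
      ∃ (a : 𝔽ˣ) (b : 𝔽), a ∈ Subgroup.zpowers (ζ ^ n) ∧ ∀ x : 𝔽, h x = ↑a * x + b)
    (G : Subgroup (Equiv.Perm (𝔽 × Fin d)))
    (hG : ∀ g : Equiv.Perm (𝔽 × Fin d), g ∈ G ↔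
      ∃ (h : Fin d → Equiv.Perm 𝔽) (σ : Equiv.Perm (Fin d)),
        (∀ j : Fin d, h j ∈ H) ∧ ∀ p : 𝔽 × Fin d, g p = (h p.2 p.1, σ p.2)) :
    -- (a) the partition into the classes `C_j = 𝔽 × {j}` is `G`-invariant and nontrivial
    ((∀ g ∈ G, ∀ j : Fin d, ∃ j' : Fin d,
        (Finset.univ.filter fun p : 𝔽 × Fin d => p.2 = j).image ⇑g =
          Finset.univ.filter fun p : 𝔽 × Fin d => p.2 = j') ∧
     1 < d ∧ 1 < c) ∧
    -- (b) `G` is transitive on outer pairs, and there are `c²d(d−1)/2` of them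
    ((∀ p q p' q' : 𝔽 × Fin d, p.2 ≠ q.2 → p'.2 ≠ q'.2 →
        ∃ g ∈ G, ({p, q} : Finset (𝔽 × Fin d)).image ⇑g = {p', q'}) ∧
     Set.ncard {s : Finset (𝔽 × Fin d) | ∃ p q : 𝔽 × Fin d, p.2 ≠ q.2 ∧ s = {p, q}} =
       c ^ 2 * d * (d - 1) / 2) ∧
    -- (c) `G` has exactly `n` orbits on inner pairs, namely the sets `𝒪_{inn,i}`,
    -- each of size `dc(c−1)/(2n)`
    ((∀ (j j' : Fin d) (x y x' y' : 𝔽), x ≠ y → x' ≠ y' →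
        ((∃ g ∈ G, ({(x, j), (y, j)} : Finset (𝔽 × Fin d)).image ⇑g = {(x', j'), (y', j')})
          ↔ ∃ u : 𝔽ˣ, u ∈ Subgroup.zpowers (ζ ^ n) ∧ y' - x' = ↑u * (y - x))) ∧
     (∀ i : ℕ, i < n →
        Set.ncard {s : Finset (𝔽 × Fin d) | ∃ (j : Fin d) (x y : 𝔽), s = {(x, j), (y, j)} ∧
          ∃ u : 𝔽ˣ, u ∈ Subgroup.zpowers (ζ ^ n) ∧ y - x = (↑ζ : 𝔽) ^ i * ↑u} =
          d * c * (c - 1) / (2 * n)) ∧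
     Set.ncard {O : Set (Finset (𝔽 × Fin d)) | ∃ (j : Fin d) (x y : 𝔽), x ≠ y ∧
        O = {t | ∃ g ∈ G, ({(x, j), (y, j)} : Finset (𝔽 × Fin d)).image ⇑g = t}} = n) := by
  have hc1 : 1 < c := hcard ▸ Fintype.one_lt_card
  have hunits : Nat.card 𝔽ˣ = c - 1 := by
    rw [Nat.card_units, Nat.card_eq_fintype_card, hcard]
  have h2n : 2 * n ∣ Nat.card 𝔽ˣ := by
    rw [hunits, ← hmod]
    exact Nat.dvd_sub_mod c
  have hndvd : n ∣ Nat.card 𝔽ˣ := (Dvd.intro_left 2 rfl).trans h2n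
  set K := Subgroup.zpowers (ζ ^ n)
  have hneg : (-1 : 𝔽ˣ) ∈ K := mem_zpowers_pow_of_sq_eq_one hζ h2n (by simp)
  have hwreath : ∀ (h : Fin d → Equiv.Perm 𝔽) (σ : Equiv.Perm (Fin d)),
      (∀ j, h j ∈ H) → wreathPerm h σ ∈ G := fun h σ hh => (hG _).2 ⟨h, σ, hh, fun _ => rfl⟩
  have haffine : ∀ a ∈ K, ∀ b, affinePerm a b ∈ H :=
    fun a ha b => (hH _).2 ⟨a, b, ha, fun _ => rfl⟩
  have hinner : ∀ (j j' : Fin d) (x y x' y' : 𝔽),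
      (∃ g ∈ G, ({(x, j), (y, j)} : Finset (𝔽 × Fin d)).image ⇑g = {(x', j'), (y', j')}) ↔
        ∃ u : 𝔽ˣ, u ∈ K ∧ y' - x' = ↑u * (y - x) := by
    intro j j' x y x' y'
    constructor
    · rintro ⟨g, hg, hgs⟩
      obtain ⟨h, σ, hh, hgσ⟩ := (hG g).1 hg
      obtain ⟨a, b, ha, hab⟩ := (hH _).1 (hh j)
      rw [← Finset.coe_inj] at hgs
      simp only [Finset.image_insert, Finset.image_singleton, hgσ, hab, Finset.coe_insert,
        Finset.coe_singleton, Set.pair_eq_pair_iff, Prod.mk.injEq] at hgs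
      obtain ⟨⟨rfl, -⟩, rfl, -⟩ | ⟨⟨rfl, -⟩, rfl, -⟩ := hgs
      · exact ⟨a, ha, by ring⟩
      · exact ⟨-1 * a, K.mul_mem hneg ha, by push_cast; ring⟩
    · rintro ⟨u, hu, huv⟩
      refine ⟨wreathPerm (fun _ => affinePerm u (x' - u * x)) (Equiv.swap j j'),
        hwreath _ _ fun _ => haffine u hu _, ?_⟩
      simp only [Finset.image_insert, Finset.image_singleton, wreathPerm_apply, affinePerm_apply,
        Equiv.swap_apply_left]
      congr 3
      · ring
      · rw [← sub_eq_zero]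
        linear_combination -huv
  refine ⟨⟨?_, by omega, hc1⟩, ⟨?_, ?_⟩, fun j j' x y x' y' _ _ => hinner j j' x y x' y', ?_, ?_⟩
  · intro g hg j
    obtain ⟨h, σ, -, hgσ⟩ := (hG g).1 hg
    refine ⟨σ j, ?_⟩
    ext p
    simp only [Finset.mem_image, Finset.mem_filter, Finset.mem_univ, true_and]
    constructor
    · rintro ⟨q, rfl, rfl⟩
      rw [hgσ]
    · intro hp
      refine ⟨g.symm p, ?_, g.apply_symm_apply p⟩
      rw [← σ.injective.eq_iff, ← hp]
      exact congrArg Prod.snd ((hgσ (g.symm p)).symm.trans (g.apply_symm_apply p))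
  · rintro ⟨x, j⟩ ⟨y, k⟩ ⟨x', j'⟩ ⟨y', k'⟩ hjk hjk'
    obtain ⟨σ, rfl, rfl⟩ := exists_perm_apply_eq_and_apply_eq hjk hjk'
    refine ⟨wreathPerm (fun i => affinePerm 1 (if i = j then x' - x else y' - y)) σ,
      hwreath _ _ fun _ => haffine 1 K.one_mem _, ?_⟩
    have hkj : k ≠ j := Ne.symm hjk
    simp [wreathPerm_apply, affinePerm_apply, Finset.image_insert, hkj]
  · have hcount := two_mul_ncard_unorderedPairs
      (ι := (𝔽 × 𝔽) × {q : Fin d × Fin d // q ∈ (Finset.univ : Finset (Fin d)).offDiag})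
      (fun i => ((i.1.1, i.2.1.1), (i.1.2, i.2.1.2))) ?_ ?_ ?_
    · have hcardι : Fintype.card ((𝔽 × 𝔽) ×
          {q : Fin d × Fin d // q ∈ (Finset.univ : Finset (Fin d)).offDiag}) =
          c ^ 2 * d * (d - 1) := by
        rw [Fintype.card_prod, Fintype.card_prod, hcard, Fintype.card_coe, Finset.offDiag_card,
          Finset.card_univ, Fintype.card_fin, ← Nat.mul_sub_one, sq, mul_assoc (c * c)]
      rw [← hcardι, ← hcount, Nat.mul_div_cancel_left _ two_pos]
      congr 1
      ext s
      constructor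
      · rintro ⟨⟨x, j⟩, ⟨y, k⟩, hjk, rfl⟩
        exact ⟨((x, y), ⟨(j, k), by simpa using hjk⟩), rfl⟩
      · rintro ⟨⟨⟨x, y⟩, ⟨⟨j, k⟩, hjk⟩⟩, rfl⟩
        exact ⟨(x, j), (y, k), by simpa using hjk, rfl⟩
    · rintro ⟨⟨x, y⟩, ⟨⟨j, k⟩, hjk⟩⟩ ⟨⟨x', y'⟩, ⟨⟨j', k'⟩, hjk'⟩⟩ h
      simp only [Prod.mk.injEq] at h
      obtain ⟨⟨rfl, rfl⟩, rfl, rfl⟩ := h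
      rfl
    · rintro ⟨⟨x, y⟩, ⟨⟨j, k⟩, hjk⟩⟩ h
      exact (Finset.mem_offDiag.1 hjk).2.2 (congrArg Prod.snd h)
    · rintro ⟨⟨x, y⟩, ⟨⟨j, k⟩, hjk⟩⟩
      exact ⟨((y, x), ⟨(k, j), by simpa [eq_comm] using hjk⟩), rfl⟩
  · intro i _
    classical
    have hcount := two_mul_ncard_unorderedPairs (ι := (Fin d × 𝔽) × K)
      (fun q => ((q.1.2, q.1.1), (q.1.2 + (ζ : 𝔽) ^ i * ((q.2 : 𝔽ˣ) : 𝔽), q.1.1))) ?_ ?_ ?_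
    · have hcardι : Fintype.card ((Fin d × 𝔽) × K) * n = d * c * (c - 1) := by
        rw [Fintype.card_prod, Fintype.card_prod, hcard, Fintype.card_fin, mul_assoc,
          ← Nat.card_eq_fintype_card (α := K), card_zpowers_pow_mul hζ hndvd, hunits]
      rw [← hcardι, ← hcount, mul_right_comm, Nat.mul_div_cancel_left _ (by positivity)]
      congr 1
      ext s
      constructor
      · rintro ⟨j, x, y, rfl, u, hu, huv⟩
        exact ⟨((j, x), ⟨u, hu⟩), by simp [← huv]⟩
      · rintro ⟨⟨⟨j, x⟩, ⟨u, hu⟩⟩, rfl⟩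
        exact ⟨j, x, _, rfl, u, hu, by ring⟩
    · rintro ⟨⟨j, x⟩, u⟩ ⟨⟨j', x'⟩, u'⟩ h
      simp only [Prod.mk.injEq] at h
      obtain ⟨⟨rfl, rfl⟩, h, -⟩ := h
      have hu := mul_left_cancel₀ (pow_ne_zero i ζ.ne_zero) (add_left_cancel h)
      rw [Subtype.ext (Units.ext hu)]
    · rintro ⟨⟨j, x⟩, u⟩ h
      simpa using congrArg Prod.fst h
    · rintro ⟨⟨j, x⟩, ⟨u, hu⟩⟩
      refine ⟨((j, x + (ζ : 𝔽) ^ i * u), ⟨-1 * u, K.mul_mem hneg hu⟩), ?_⟩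
      simp
  · let j₀ : Fin d := ⟨0, by omega⟩
    let orbit : 𝔽ˣ → Set (Finset (𝔽 × Fin d)) := fun a =>
      {t | ∃ g ∈ G, ({(0, j₀), (↑a, j₀)} : Finset (𝔽 × Fin d)).image ⇑g = t}
    have horbit : ∀ a b, orbit a = orbit b ↔ a⁻¹ * b ∈ K := by
      intro a b
      rw [imageOrbit_eq_iff, hinner]
      simp only [sub_zero]
      constructor
      · rintro ⟨u, hu, huv⟩
        rw [← Units.val_mul, Units.val_inj] at huv
        rwa [huv, mul_comm u, inv_mul_cancel_left]
      · intro h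
        exact ⟨_, h, by simp [mul_comm]⟩
    let φ : 𝔽ˣ ⧸ K → Set (Finset (𝔽 × Fin d)) := fun q =>
      Quotient.liftOn' q orbit fun a b h => (horbit a b).2 (QuotientGroup.leftRel_apply.1 h)
    have hφ : Function.Injective φ := by
      intro a b
      refine Quotient.inductionOn₂' a b fun a b h => ?_
      exact QuotientGroup.eq.2 ((horbit a b).1 h)
    rw [← index_zpowers_pow hζ hndvd, Subgroup.index, ← Set.ncard_univ,
      ← Set.ncard_image_of_injective _ hφ]
    congr 1
    ext O
    simp only [Set.image_univ, Set.mem_range, Set.mem_ofPred_eq]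
    constructor
    · rintro ⟨j, x, y, hxy, rfl⟩
      refine ⟨QuotientGroup.mk (Units.mk0 (y - x) (sub_ne_zero.2 hxy.symm)), ?_⟩
      exact (imageOrbit_eq_iff _ _ _).2 ((hinner _ _ _ _ _ _).2 ⟨1, K.one_mem, by simp⟩)
    · rintro ⟨q, rfl⟩
      refine Quotient.inductionOn' q fun a => ?_
      exact ⟨j₀, 0, a, a.ne_zero.symm, rfl⟩
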